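/- (O(1/√n)-optimality of square-root staffing in the M/M/N queue.) Let x̄* be the unique minimizer over (0,∞) of π̄(x) = c·x + h·q̄(x), where q̄(x) = (1/x)·(1 + x·Φ(x)/φ(x))^{-1}. Then the optimality gap of the square-root staffing prescription is O(1/√n): limsup_{n→∞} √n·[ Π_n(n/μ + √(n/μ)·x̄*) - inf_{x > n/μ} Π_n(x) ] < ∞. -/

import Mathlib

open Filter Topology Set
open MeasureTheory

/-- The integrand of the extended Erlang-C formula. -/
noncomputable def erlangKernel (R y t : ℝ) : ℝ := t * Real.exp (-R * t) * (1 + t) ^ y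

lemma erlangKernel_pos (R y : ℝ) {t : ℝ} (ht : 0 < t) : 0 < erlangKernel R y t := by
  unfold erlangKernel; positivity

lemma measurable_erlangKernel (R y : ℝ) : Measurable (erlangKernel R y) := by
  unfold erlangKernel; fun_prop

lemma erlangKernel_add (R y γ : ℝ) {t : ℝ} (ht : 0 < t) :
    erlangKernel R (y + γ) t = (1 + t) ^ γ * erlangKernel R y t := by
  unfold erlangKernel
  rw [Real.rpow_add (by linarith)]
  ring

lemma integrableOn_erlangKernel {R : ℝ} (hR : 0 < R) (y : ℝ) :
    IntegrableOn (erlangKernel R y) (Ioi 0) := by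
  apply integrable_of_isBigO_exp_neg (half_pos hR)
  · unfold erlangKernel
    refine ContinuousOn.mul (by fun_prop) (ContinuousOn.rpow_const (by fun_prop) ?_)
    intro t ht
    left
    have : (0 : ℝ) ≤ t := ht
    positivity
  · have h1 : (fun t : ℝ => (1 + t) ^ (y + 1)) =O[atTop] fun t => Real.exp (R / 2 * (1 + t)) :=
      ((isLittleO_rpow_exp_pos_mul_atTop (y + 1) (half_pos hR)).comp_tendsto
        (tendsto_atTop_add_const_left atTop (1 : ℝ) tendsto_id)).isBigO
    have h2 : (fun t : ℝ => Real.exp (-R * t) * (1 + t) ^ (y + 1)) =O[atTop]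
        fun t => Real.exp (-R * t) * Real.exp (R / 2 * (1 + t)) :=
      (Asymptotics.isBigO_refl _ _).mul h1
    refine Asymptotics.IsBigO.trans ?_ (h2.trans ?_)
    · refine Asymptotics.IsBigO.of_bound 1 ?_
      filter_upwards [eventually_gt_atTop 0] with t ht
      rw [Real.norm_of_nonneg (erlangKernel_pos R y ht).le, Real.norm_of_nonneg (by positivity),
        Real.rpow_add_one (by positivity)]
      unfold erlangKernel
      have : 0 < Real.exp (-R * t) * (1 + t) ^ y := by positivity
      nlinarith
    · refine Asymptotics.IsBigO.of_bound (Real.exp (R / 2)) (Eventually.of_forall fun t => ?_)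
      rw [Real.norm_of_nonneg (by positivity), Real.norm_of_nonneg (by positivity),
        ← Real.exp_add, ← Real.exp_add]
      apply le_of_eq
      ring_nf

lemma integrableOn_log_mul_erlangKernel {R : ℝ} (hR : 0 < R) (y : ℝ) :
    IntegrableOn (fun t => Real.log (1 + t) * erlangKernel R y t) (Ioi 0) := by
  have hm := measurable_erlangKernel R y
  refine (integrableOn_erlangKernel hR (y + 1)).mono' (by fun_prop) ?_
  refine (ae_restrict_iff' measurableSet_Ioi).2 (Eventually.of_forall fun t ht => ?_)
  have ht : 0 < t := ht
  have h1 : 0 ≤ Real.log (1 + t) := Real.log_nonneg (by linarith)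
  have h2 : Real.log (1 + t) ≤ 1 + t := (Real.log_le_sub_one_of_pos (by linarith)).trans (by linarith)
  have h3 := erlangKernel_pos R y ht
  rw [Real.norm_of_nonneg (by positivity), erlangKernel_add R y 1 ht, Real.rpow_one]
  gcongr

/-- Tonelli's theorem in tail form: `∫ G w = ∫ g(s) (∫_s^∞ w) ds` for a primitive `G` of `g`. -/
lemma integral_primitive_mul_eq_integral_mul_tail {g G w : ℝ → ℝ} (hgm : Measurable g)
    (hwm : Measurable w) (hg0 : ∀ s, 0 < s → 0 ≤ g s) (hw0 : ∀ t, 0 < t → 0 ≤ w t)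
    (hgi : ∀ t, 0 < t → IntervalIntegrable g volume 0 t)
    (hG : ∀ t, 0 < t → ∫ s in (0 : ℝ)..t, g s = G t)
    (hGw : IntegrableOn (fun t => G t * w t) (Ioi 0)) :
    IntegrableOn (fun s => g s * ∫ t in Ioi s, w t) (Ioi 0) ∧
      ∫ t in Ioi (0 : ℝ), G t * w t = ∫ s in Ioi (0 : ℝ), g s * ∫ t in Ioi s, w t := by
  set ν : Measure ℝ := volume.restrict (Ioi 0) with hν
  let f : ℝ → ℝ → ℝ := fun s t => {p : ℝ × ℝ | p.1 < p.2}.indicator (fun p => g p.1 * w p.2) (s, t)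
  have hset : MeasurableSet {p : ℝ × ℝ | p.1 < p.2} := measurableSet_lt measurable_fst measurable_snd
  have hfm : Measurable (Function.uncurry f) :=
    Measurable.indicator (by fun_prop) hset
  have hf1 : ∀ t, (fun s => f s t) = (Iio t).indicator (fun s => g s * w t) := by
    intro t; ext s; simp [f, indicator_apply]
  have hf2 : ∀ s, (fun t => f s t) = (Ioi s).indicator (fun t => g s * w t) := by
    intro s; ext t; simp [f, indicator_apply]
  have hf0 : ∀ s t, 0 < s → 0 < t → 0 ≤ f s t := by
    intro s t hs ht
    exact indicator_apply_nonneg fun _ => mul_nonneg (hg0 s hs) (hw0 t ht)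
  have hI1 : ∀ t, 0 < t → ∫ s, f s t ∂ν = G t * w t := by
    intro t ht
    rw [hf1, integral_indicator measurableSet_Iio, hν, Measure.restrict_restrict measurableSet_Iio,
      integral_mul_const, ← hG t ht, intervalIntegral.integral_of_le ht.le,
      integral_Ioc_eq_integral_Ioo, inter_comm, Ioi_inter_Iio]
  have hI2 : ∀ s, 0 < s → ∫ t, f s t ∂ν = g s * ∫ t in Ioi s, w t := by
    intro s hs
    rw [hf2, integral_indicator measurableSet_Ioi, hν, Measure.restrict_restrict measurableSet_Ioi,
      integral_const_mul, Ioi_inter_Ioi, sup_of_le_left hs.le]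
  have hint : Integrable (Function.uncurry f) (ν.prod ν) := by
    rw [integrable_prod_iff' hfm.aestronglyMeasurable]
    constructor
    · refine (ae_restrict_iff' measurableSet_Ioi).2 (Eventually.of_forall fun t ht => ?_)
      change Integrable (fun s => f s t) ν
      rw [hf1, integrable_indicator_iff measurableSet_Iio, IntegrableOn, hν,
        Measure.restrict_restrict measurableSet_Iio, inter_comm, Ioi_inter_Iio]
      exact (((hgi t ht).1).mono_set Ioo_subset_Ioc_self).mul_const _
    · refine hGw.congr ?_
      refine (ae_restrict_iff' measurableSet_Ioi).2 (Eventually.of_forall fun t ht => ?_)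
      change G t * w t = ∫ s, ‖f s t‖ ∂ν
      rw [← hI1 t ht]
      refine setIntegral_congr_fun measurableSet_Ioi fun s hs => ?_
      exact (Real.norm_of_nonneg (hf0 s t hs ht)).symm
  constructor
  · refine hint.integral_prod_left.congr ?_
    exact (ae_restrict_iff' measurableSet_Ioi).2 (Eventually.of_forall fun s hs => hI2 s hs)
  · have := integral_integral_swap hint
    rw [hν] at this
    rw [← setIntegral_congr_fun measurableSet_Ioi fun s hs => hI2 s hs,
      ← setIntegral_congr_fun measurableSet_Ioi fun s hs => hI1 s hs]
    exact this.symm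

/-- The tail of the kernel, relative to the kernel itself, is decreasing. -/
lemma erlangKernel_tail_antitone {R : ℝ} (hR : 0 < R) (y : ℝ) :
    AntitoneOn (fun s => (∫ t in Ioi s, erlangKernel R y t) / ((1 + s) * erlangKernel R y s))
      (Ioi 0) := by
  have key : ∀ s, 0 < s → IntegrableOn (fun v => ((1 + v) + v / s) * Real.exp (-R * (1 + s) * v)
        * (1 + v) ^ y) (Ioi 0) ∧ (∫ t in Ioi s, erlangKernel R y t) / ((1 + s) * erlangKernel R y s)
      = ∫ v in Ioi (0 : ℝ), ((1 + v) + v / s) * Real.exp (-R * (1 + s) * v) * (1 + v) ^ y := by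
    intro s hs
    have hpt : ∀ v ∈ Ioi (0 : ℝ), erlangKernel R y ((1 + s) * v + s) / erlangKernel R y s
        = ((1 + v) + v / s) * Real.exp (-R * (1 + s) * v) * (1 + v) ^ y := by
      intro v hv
      have hv : 0 < v := hv
      have h1 : 1 + ((1 + s) * v + s) = (1 + s) * (1 + v) := by ring
      have h2 : -R * ((1 + s) * v + s) = -R * (1 + s) * v + -R * s := by ring
      unfold erlangKernel
      rw [h1, h2, Real.exp_add, Real.mul_rpow (by positivity) (by positivity)]
      have : 0 < (1 + s) ^ y := by positivity
      field_simp
      ring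
    have hsub : ∫ v in Ioi (0 : ℝ), erlangKernel R y ((1 + s) * v + s)
        = (1 + s)⁻¹ * ∫ t in Ioi s, erlangKernel R y t := by
      rw [integral_comp_mul_left_Ioi (fun z => erlangKernel R y (z + s)) 0 (by positivity : 0 < 1 + s),
        mul_zero, smul_eq_mul]
      congr 1
      have := (measurePreserving_add_right volume s).setIntegral_preimage_emb
        (measurableEmbedding_addRight s) (erlangKernel R y) (Ioi s)
      simpa using this
    have hi : IntegrableOn (fun v => erlangKernel R y ((1 + s) * v + s)) (Ioi 0) := by
      have := (integrableOn_Ioi_comp_mul_left_iff (fun z => erlangKernel R y (z + s)) 0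
        (by positivity : 0 < 1 + s)).2
      apply this
      rw [mul_zero]
      have h2 := (integrableOn_erlangKernel hR y).mono_set (Ioi_subset_Ioi hs.le)
      have := (measurePreserving_add_right volume s).integrableOn_comp_preimage
        (measurableEmbedding_addRight s) (s := Ioi s) (f := erlangKernel R y)
      simpa [Function.comp_def] using this.2 h2
    constructor
    · exact (integrableOn_congr_fun hpt measurableSet_Ioi).1 (hi.div_const _)
    · rw [← setIntegral_congr_fun measurableSet_Ioi hpt, integral_div, hsub]
      have := erlangKernel_pos R y hs
      field_simp
  intro s hs s' hs' hss
  have hs : 0 < s := hs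
  have hs' : 0 < s' := hs'
  simp only
  rw [(key s hs).2, (key s' hs').2]
  refine setIntegral_mono_on (key s' hs').1 (key s hs).1 measurableSet_Ioi fun v hv => ?_
  have hv : 0 < v := hv
  gcongr ?_ * Real.exp ?_ * _
  · gcongr
  · have : R * (1 + s) * v ≤ R * (1 + s') * v := by gcongr
    linarith

lemma setIntegral_Ioi_pos {f : ℝ → ℝ} (hf : IntegrableOn f (Ioi 0)) (hpos : ∀ t, 0 < t → 0 < f t) :
    0 < ∫ t in Ioi (0 : ℝ), f t := by
  rw [setIntegral_pos_iff_support_of_nonneg_ae]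
  · have : Ioi 0 ⊆ Function.support f := fun t ht => (hpos t ht).ne'
    rw [inter_eq_right.2 this]
    simp
  · exact (ae_restrict_iff' measurableSet_Ioi).2 (Eventually.of_forall fun t ht => (hpos t ht).le)
  · exact hf

lemma integral_erlangKernel_pos {R : ℝ} (hR : 0 < R) (y : ℝ) :
    0 < ∫ t in Ioi (0 : ℝ), erlangKernel R y t :=
  setIntegral_Ioi_pos (integrableOn_erlangKernel hR y) fun _ => erlangKernel_pos R y

/-- The tangent-line inequality expressing that the reciprocal of the Erlang integral is convex. -/
lemma erlangIntegral_tangent {R : ℝ} (hR : 0 < R) (y γ : ℝ) :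
    (∫ t in Ioi (0 : ℝ), erlangKernel R y t) *
      ((∫ t in Ioi (0 : ℝ), erlangKernel R (y + γ) t) - ∫ t in Ioi (0 : ℝ), erlangKernel R y t)
      ≤ γ * (∫ t in Ioi (0 : ℝ), Real.log (1 + t) * erlangKernel R y t) *
        ∫ t in Ioi (0 : ℝ), erlangKernel R (y + γ) t := by
  rcases eq_or_ne γ 0 with rfl | hγ
  · simp
  set w := erlangKernel R y with hw
  set W := ∫ t in Ioi (0 : ℝ), w t with hW
  set V := ∫ t in Ioi (0 : ℝ), erlangKernel R (y + γ) t with hV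
  set S : ℝ → ℝ := fun s => ∫ t in Ioi s, w t with hS
  have hWpos : 0 < W := integral_erlangKernel_pos hR y
  have hVpos : 0 < V := integral_erlangKernel_pos hR (y + γ)
  have hwm : Measurable w := measurable_erlangKernel R y
  have hw0 : ∀ t, 0 < t → 0 ≤ w t := fun t ht => (erlangKernel_pos R y ht).le
  have hwi : IntegrableOn w (Ioi 0) := integrableOn_erlangKernel hR y
  have hVi : IntegrableOn (erlangKernel R (y + γ)) (Ioi 0) := integrableOn_erlangKernel hR _
  have hcont : ∀ (e : ℝ) (t : ℝ), 0 < t →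
      ContinuousOn (fun s : ℝ => (1 + s) ^ e) (uIcc 0 t) := by
    intro e t ht
    refine ContinuousOn.rpow_const (by fun_prop) fun s hs => ?_
    rw [uIcc_of_le ht.le] at hs
    left
    linarith [hs.1]
  have hFw : IntegrableOn (fun t => ((1 + t) ^ γ - 1) / γ * w t) (Ioi 0) := by
    refine (integrableOn_congr_fun (fun t ht => ?_) measurableSet_Ioi).1
      ((hVi.sub hwi).div_const γ)
    simp only [Pi.sub_apply]
    rw [erlangKernel_add R y γ ht]
    ring
  have hF := integral_primitive_mul_eq_integral_mul_tail (g := fun s => (1 + s) ^ (γ - 1))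
    (G := fun t => ((1 + t) ^ γ - 1) / γ) (w := w) (by fun_prop) hwm
    (fun s hs => by positivity) hw0 (fun t ht => (hcont _ t ht).intervalIntegrable)
    (fun t ht => by
      have := intervalIntegral.integral_eq_sub_of_hasDerivAt (a := 0) (b := t)
        (f := fun s : ℝ => (1 + s) ^ γ / γ) (f' := fun s => (1 + s) ^ (γ - 1))
        (fun s hs => by
          rw [uIcc_of_le ht.le] at hs
          have h1 : HasDerivAt (fun s : ℝ => 1 + s) 1 s := (hasDerivAt_id s).const_add 1
          have := (h1.rpow_const (p := γ) (Or.inl (by linarith [hs.1]))).div_const γ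
          refine this.congr_deriv ?_
          rw [one_mul, mul_div_cancel_left₀ _ hγ]) (hcont _ t ht).intervalIntegrable
      rw [this]
      simp
      ring) hFw
  have hL := integral_primitive_mul_eq_integral_mul_tail (g := fun s => (1 + s) ^ (-1 : ℝ))
    (G := fun t => Real.log (1 + t)) (w := w) (by fun_prop) hwm
    (fun s hs => by positivity) hw0 (fun t ht => (hcont _ t ht).intervalIntegrable)
    (fun t ht => by
      have := intervalIntegral.integral_eq_sub_of_hasDerivAt (a := 0) (b := t)
        (f := fun s : ℝ => Real.log (1 + s)) (f' := fun s => (1 + s) ^ (-1 : ℝ))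
        (fun s hs => by
          rw [uIcc_of_le ht.le] at hs
          have h1 : HasDerivAt (fun s : ℝ => 1 + s) 1 s := (hasDerivAt_id s).const_add 1
          have := h1.log (by linarith [hs.1])
          exact this.congr_deriv (by rw [Real.rpow_neg_one, one_div])) (hcont _ t ht).intervalIntegrable
      rw [this]
      simp) (integrableOn_log_mul_erlangKernel hR y)
  obtain ⟨hFi, hFe⟩ := hF
  obtain ⟨hLi, hLe⟩ := hL
  have hFV : ∫ t in Ioi (0 : ℝ), ((1 + t) ^ γ - 1) / γ * w t = (V - W) / γ := by
    rw [hV, hW, ← integral_sub hVi hwi, ← integral_div]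
    refine setIntegral_congr_fun measurableSet_Ioi fun t ht => ?_
    rw [erlangKernel_add R y γ ht]
    ring
  have hFVpos : 0 < (V - W) / γ := by
    rw [← hFV]
    refine setIntegral_Ioi_pos hFw fun t ht => mul_pos ?_ (erlangKernel_pos R y ht)
    rcases lt_or_gt_of_ne hγ with h | h
    · have := Real.rpow_lt_one_of_one_lt_of_neg (by linarith : 1 < 1 + t) h
      exact div_pos_of_neg_of_neg (by linarith) h
    · have := Real.one_lt_rpow (by linarith : 1 < 1 + t) h
      exact div_pos (by linarith) h
  rw [hFV] at hFe
  rw [hLe]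
  set r : ℝ → ℝ := fun s => S s / ((1 + s) * w s) with hr
  have hanti : AntitoneOn r (Ioi 0) := erlangKernel_tail_antitone hR y
  -- Chebyshev's inequality for the tilt `(1 + s) ^ γ` and the tail ratio `r`
  set f0 := V / W with hf0
  have hf0pos : 0 < f0 := by positivity
  have hsign : ∃ r0, ∀ s, 0 < s → γ * (((1 + s) ^ γ - f0) * (r s - r0)) ≤ 0 := by
    have h1 : (f0 ^ γ⁻¹) ^ γ = f0 := Real.rpow_inv_rpow hf0pos.le hγ
    have h2 : 1 < f0 ^ γ⁻¹ := by
      rcases lt_or_gt_of_ne hγ with h | h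
      · have : V - W < 0 := by
          by_contra! h'
          exact absurd hFVpos (not_lt.2 (div_nonpos_of_nonneg_of_nonpos h' h.le))
        refine Real.one_lt_rpow_of_pos_of_lt_one_of_neg hf0pos ?_ (inv_lt_zero.2 h)
        rw [hf0, div_lt_one hWpos]
        linarith
      · have : 0 < V - W := by
          rwa [lt_div_iff₀ h, zero_mul] at hFVpos
        refine Real.one_lt_rpow ?_ (inv_pos.2 h)
        rw [hf0, one_lt_div hWpos]
        linarith
    refine ⟨r (f0 ^ γ⁻¹ - 1), fun s hs => ?_⟩
    have h3 : f0 ^ γ⁻¹ - 1 ∈ Ioi (0 : ℝ) := sub_pos.2 h2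
    rw [← mul_assoc]
    rcases le_total s (f0 ^ γ⁻¹ - 1) with h | h
    · refine mul_nonpos_of_nonpos_of_nonneg ?_ (sub_nonneg.2 (hanti hs h3 h))
      rcases lt_or_gt_of_ne hγ with hγ' | hγ'
      · refine mul_nonpos_of_nonpos_of_nonneg hγ'.le (sub_nonneg.2 ?_)
        conv_lhs => rw [← h1]
        exact Real.rpow_le_rpow_of_nonpos (by linarith) (by linarith) hγ'.le
      · refine mul_nonpos_of_nonneg_of_nonpos hγ'.le (sub_nonpos.2 ?_)
        conv_rhs => rw [← h1]
        exact Real.rpow_le_rpow (by linarith) (by linarith) hγ'.le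
    · refine mul_nonpos_of_nonneg_of_nonpos ?_ (sub_nonpos.2 (hanti h3 hs h))
      rcases lt_or_gt_of_ne hγ with hγ' | hγ'
      · refine mul_nonneg_of_nonpos_of_nonpos hγ'.le (sub_nonpos.2 ?_)
        conv_rhs => rw [← h1]
        exact Real.rpow_le_rpow_of_nonpos (by linarith) (by linarith) hγ'.le
      · refine mul_nonneg hγ'.le (sub_nonneg.2 ?_)
        conv_lhs => rw [← h1]
        exact Real.rpow_le_rpow (by linarith) (by linarith) hγ'.le
  obtain ⟨r0, hr0⟩ := hsign
  have hle : ∫ s in Ioi (0 : ℝ), γ * (((1 + s) ^ (γ - 1) * S s - f0 * ((1 + s) ^ (-1 : ℝ) * S s))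
      - r0 * (erlangKernel R (y + γ) s - f0 * w s)) ≤ 0 := by
    refine setIntegral_nonpos measurableSet_Ioi fun s hs => ?_
    have hs : 0 < s := hs
    have h1 := erlangKernel_pos R y hs
    have h2 : S s = r s * ((1 + s) * w s) := by
      have : 0 < w s := h1
      exact (div_mul_cancel₀ _ (by positivity)).symm
    have h3 := mul_nonpos_of_nonpos_of_nonneg (hr0 s hs) h1.le
    refine le_of_eq_of_le ?_ h3
    rw [erlangKernel_add R y γ hs, h2, Real.rpow_sub_one (by positivity), Real.rpow_neg_one]
    field_simp
    ring
  have hFi' : Integrable (fun s => (1 + s) ^ (γ - 1) * S s) (volume.restrict (Ioi 0)) := hFi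
  have hLi' : Integrable (fun s => (1 + s) ^ (-1 : ℝ) * S s) (volume.restrict (Ioi 0)) := hLi
  have hval : ∫ s in Ioi (0 : ℝ), γ * (((1 + s) ^ (γ - 1) * S s - f0 * ((1 + s) ^ (-1 : ℝ) * S s))
      - r0 * (erlangKernel R (y + γ) s - f0 * w s)) = γ * (((V - W) / γ
        - f0 * ∫ s in Ioi (0 : ℝ), (1 + s) ^ (-1 : ℝ) * S s) - r0 * (V - f0 * W)) := by
    have e1 : ∫ s in Ioi (0 : ℝ), ((1 + s) ^ (γ - 1) * S s - f0 * ((1 + s) ^ (-1 : ℝ) * S s))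
        = (V - W) / γ - f0 * ∫ s in Ioi (0 : ℝ), (1 + s) ^ (-1 : ℝ) * S s := by
      rw [integral_sub hFi' (hLi'.const_mul f0), integral_const_mul, hFe]
    have e2 : ∫ s in Ioi (0 : ℝ), (erlangKernel R (y + γ) s - f0 * w s) = V - f0 * W := by
      rw [integral_sub hVi (hwi.const_mul f0), integral_const_mul]
    rw [integral_const_mul, ← e1, ← e2, ← integral_const_mul r0]
    congr 1
    exact integral_sub (hFi'.sub (hLi'.const_mul f0)) ((hVi.sub (hwi.const_mul f0)).const_mul r0)
  rw [hval, hf0, div_mul_cancel₀ _ hWpos.ne', sub_self, mul_zero, sub_zero] at hle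
  set T := ∫ s in Ioi (0 : ℝ), (1 + s) ^ (-1 : ℝ) * S s
  have h5 : γ * ((V - W) / γ - V / W * T) * W = W * (V - W) - γ * T * V := by
    field_simp
  nlinarith [mul_nonpos_of_nonpos_of_nonneg hle hWpos.le]

lemma log_one_add_le_cubic {x : ℝ} (hx : 0 ≤ x) :
    Real.log (1 + x) ≤ x - x ^ 2 / 2 + x ^ 3 / 3 := by
  have hd : ∀ z : ℝ, 0 ≤ z → HasDerivAt (fun z : ℝ => z - z ^ 2 / 2 + z ^ 3 / 3 - Real.log (1 + z))
      (1 - z + z ^ 2 - 1 / (1 + z)) z := by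
    intro z hz
    have h1 : HasDerivAt (fun s : ℝ => 1 + s) 1 z := (hasDerivAt_id z).const_add 1
    have h2 := h1.log (by linarith)
    have h3 := (((hasDerivAt_id z).sub ((hasDerivAt_pow 2 z).div_const 2)).add
      ((hasDerivAt_pow 3 z).div_const 3)).sub h2
    refine h3.congr_deriv ?_
    norm_num
  have hmono : MonotoneOn (fun z : ℝ => z - z ^ 2 / 2 + z ^ 3 / 3 - Real.log (1 + z)) (Ici 0) := by
    refine monotoneOn_of_deriv_nonneg (convex_Ici 0)
      (fun z hz => (hd z hz).continuousAt.continuousWithinAt)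
      (fun z hz => ?_) (fun z hz => ?_)
    · rw [interior_Ici] at hz
      exact (hd z (le_of_lt hz)).differentiableAt.differentiableWithinAt
    · rw [interior_Ici] at hz
      have hz : 0 < z := hz
      rw [(hd z hz.le).deriv, sub_nonneg, div_le_iff₀ (by linarith)]
      nlinarith [pow_pos hz 3]
  have := hmono (mem_Ici.2 le_rfl) hx hx
  simp at this
  linarith

lemma quadratic_le_log_one_add {x : ℝ} (hx : 0 ≤ x) : x - x ^ 2 / 2 ≤ Real.log (1 + x) := by
  refine le_trans ?_ (Real.le_log_one_add_of_nonneg hx)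
  rw [le_div_iff₀ (by linarith)]
  nlinarith [pow_nonneg hx 3]

lemma log_one_add_le_sub_div {x : ℝ} (hx : 0 ≤ x) :
    Real.log (1 + x) ≤ x - x ^ 2 / (2 * (1 + x)) := by
  have h1 : Real.log (1 + x) ≤ Real.sinh (Real.log (1 + x)) :=
    Real.self_le_sinh_iff.2 (Real.log_nonneg (by linarith))
  rw [Real.sinh_log (by linarith)] at h1
  refine h1.trans_eq ?_
  field_simp
  ring

lemma log_one_add_le_self {x : ℝ} (hx : 0 ≤ x) : Real.log (1 + x) ≤ x := by
  have := Real.log_le_sub_one_of_pos (by linarith : 0 < 1 + x)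
  linarith

lemma abs_exp_sub_exp_le {x y M : ℝ} (hx : x ≤ M) (hy : y ≤ M) :
    |Real.exp x - Real.exp y| ≤ |x - y| * Real.exp M := by
  wlog h : y ≤ x generalizing x y
  · rw [abs_sub_comm, abs_sub_comm x y]
    exact this hy hx (le_of_not_ge h)
  rw [abs_of_nonneg (sub_nonneg.2 (Real.exp_le_exp.2 h)), abs_of_nonneg (sub_nonneg.2 h)]
  have h1 : Real.exp y = Real.exp (y - x) * Real.exp x := by rw [← Real.exp_add]; ring_nf
  have h2 := Real.add_one_le_exp (y - x)
  have h3 := Real.exp_le_exp.2 hx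
  have h4 := Real.exp_pos x
  calc Real.exp x - Real.exp y ≤ (x - y) * Real.exp x := by rw [h1]; nlinarith
    _ ≤ (x - y) * Real.exp M := by gcongr

/-- Logarithm of the Erlang integrand in the Halfin–Whitt scaling `R = δ⁻²`. -/
noncomputable def erlangExponent (a δ s : ℝ) : ℝ :=
  -(s / δ) + ((δ ^ 2)⁻¹ + a / δ - 1) * Real.log (1 + δ * s)

lemma abs_erlangExponent_sub_le {a δ s : ℝ} (ha : 0 < a) (hδ : 0 < δ) (hs : 0 ≤ s) :
    |erlangExponent a δ s - (a * s - s ^ 2 / 2)| ≤ δ * (s ^ 3 + a * s ^ 2 + s) := by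
  have hx : 0 ≤ δ * s := by positivity
  have h1 := log_one_add_le_cubic hx
  have h2 := quadratic_le_log_one_add hx
  have h3 := log_one_add_le_self hx
  have h0 : 0 ≤ Real.log (1 + δ * s) := Real.log_nonneg (by linarith)
  have e : erlangExponent a δ s - (a * s - s ^ 2 / 2)
      = (δ ^ 2)⁻¹ * (Real.log (1 + δ * s) - (δ * s - (δ * s) ^ 2 / 2))
        - a / δ * (δ * s - Real.log (1 + δ * s)) - Real.log (1 + δ * s) := by
    unfold erlangExponent
    field_simp
    ring
  have b1 : (δ ^ 2)⁻¹ * (Real.log (1 + δ * s) - (δ * s - (δ * s) ^ 2 / 2)) ≤ δ * s ^ 3 := by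
    calc _ ≤ (δ ^ 2)⁻¹ * ((δ * s) ^ 3 / 3) := by gcongr; linarith
      _ = δ * s ^ 3 / 3 := by field_simp
      _ ≤ δ * s ^ 3 := by linarith [mul_nonneg hδ.le (pow_nonneg hs 3)]
  have b1' : 0 ≤ (δ ^ 2)⁻¹ * (Real.log (1 + δ * s) - (δ * s - (δ * s) ^ 2 / 2)) :=
    mul_nonneg (by positivity) (by linarith)
  have b2 : a / δ * (δ * s - Real.log (1 + δ * s)) ≤ δ * (a * s ^ 2) := by
    calc _ ≤ a / δ * ((δ * s) ^ 2 / 2) := by gcongr; linarith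
      _ = δ * (a * s ^ 2) / 2 := by field_simp
      _ ≤ δ * (a * s ^ 2) := by linarith [mul_nonneg hδ.le (mul_nonneg ha.le (sq_nonneg s))]
  have b2' : 0 ≤ a / δ * (δ * s - Real.log (1 + δ * s)) :=
    mul_nonneg (by positivity) (by linarith)
  have b3 : 0 ≤ δ * s ^ 3 := by positivity
  rw [e, abs_le]
  constructor <;> linarith

lemma gaussian_exponent_le (a s : ℝ) : a * s - s ^ 2 / 2 ≤ (a + 1) ^ 2 - s := by
  nlinarith [sq_nonneg (s - (a + 1)), sq_nonneg (a + 1)]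

lemma erlangExponent_le {a δ s : ℝ} (ha : 0 < a) (hδ : 0 < δ) (hδa : δ * (4 * (a + 1)) ≤ 1)
    (hs : 0 ≤ s) : erlangExponent a δ s ≤ (a + 1) ^ 2 - s := by
  have hx : 0 ≤ δ * s := by positivity
  have h0 : 0 ≤ Real.log (1 + δ * s) := Real.log_nonneg (by linarith)
  have h1 := log_one_add_le_sub_div hx
  have h3 := log_one_add_le_self hx
  have e : erlangExponent a δ s = (δ ^ 2)⁻¹ * (Real.log (1 + δ * s) - δ * s)
      + a / δ * Real.log (1 + δ * s) - Real.log (1 + δ * s) := by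
    unfold erlangExponent
    field_simp
    ring
  have b1 : (δ ^ 2)⁻¹ * (Real.log (1 + δ * s) - δ * s) ≤ -(s ^ 2 / (2 * (1 + δ * s))) := by
    calc _ ≤ (δ ^ 2)⁻¹ * (-((δ * s) ^ 2 / (2 * (1 + δ * s)))) := by gcongr; linarith
      _ = _ := by field_simp
  have b2 : a / δ * Real.log (1 + δ * s) ≤ a * s := by
    calc _ ≤ a / δ * (δ * s) := by gcongr
      _ = _ := by field_simp
  have b3 : (a + 1) * s - (a + 1) ^ 2 ≤ s ^ 2 / (2 * (1 + δ * s)) := by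
    rw [le_div_iff₀ (by positivity)]
    have : δ * (4 * (a + 1)) * s ^ 2 ≤ 1 * s ^ 2 := by gcongr
    have : 0 ≤ (a + 1) ^ 2 * (δ * s) := by positivity
    nlinarith [sq_nonneg (s - 2 * (a + 1))]
  rw [e]
  linarith

lemma integrableOn_pow_mul_exp_neg (k : ℕ) :
    IntegrableOn (fun s : ℝ => s ^ k * Real.exp (-s)) (Ioi 0) := by
  have := Real.GammaIntegral_convergent (s := k + 1) (by positivity)
  simpa [mul_comm] using this

/-- Moments of the limiting Gaussian weight on the half line. -/
lemma integrableOn_pow_mul_gaussian (a : ℝ) (k : ℕ) :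
    IntegrableOn (fun s : ℝ => s ^ k * Real.exp (a * s - s ^ 2 / 2)) (Ioi 0) := by
  refine ((integrableOn_pow_mul_exp_neg k).const_mul (Real.exp ((a + 1) ^ 2))).mono'
    (by fun_prop) ?_
  refine (ae_restrict_iff' measurableSet_Ioi).2 (Eventually.of_forall fun s hs => ?_)
  have hs : 0 < s := hs
  rw [Real.norm_of_nonneg (by positivity)]
  have h1 : Real.exp (a * s - s ^ 2 / 2) ≤ Real.exp ((a + 1) ^ 2) * Real.exp (-s) := by
    rw [← Real.exp_add]
    exact Real.exp_le_exp.2 (by linarith [gaussian_exponent_le a s])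
  calc _ ≤ s ^ k * (Real.exp ((a + 1) ^ 2) * Real.exp (-s)) := by gcongr
    _ = _ := by ring

lemma abs_integral_sub_le {f g b : ℝ → ℝ} {δ : ℝ} (hf : Measurable f)
    (hg : IntegrableOn g (Ioi 0)) (hb : IntegrableOn b (Ioi 0))
    (hfg : ∀ s, 0 < s → |f s - g s| ≤ δ * b s) :
    |(∫ s in Ioi (0 : ℝ), f s) - ∫ s in Ioi (0 : ℝ), g s| ≤ (∫ s in Ioi (0 : ℝ), b s) * δ := by
  have hae : ∀ᵐ s ∂volume.restrict (Ioi (0 : ℝ)), ‖f s - g s‖ ≤ δ * b s :=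
    (ae_restrict_iff' measurableSet_Ioi).2 (Eventually.of_forall hfg)
  have hd : IntegrableOn (fun s => f s - g s) (Ioi 0) :=
    (hb.const_mul δ).mono' (hf.aestronglyMeasurable.sub hg.aestronglyMeasurable) hae
  have hfi : IntegrableOn f (Ioi 0) := by
    refine (hd.add hg).congr (Eventually.of_forall fun s => ?_)
    simp
  rw [← integral_sub hfi hg, mul_comm, ← integral_const_mul]
  exact norm_integral_le_of_norm_le (hb.const_mul δ) hae

lemma integral_erlangExponent_sub_gaussian (a : ℝ) (ha : 0 < a) :
    ∃ B, ∀ δ, 0 < δ → δ * (4 * (a + 1)) ≤ 1 →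
      |(∫ s in Ioi (0 : ℝ), s * Real.exp (erlangExponent a δ s))
        - ∫ s in Ioi (0 : ℝ), s ^ 1 * Real.exp (a * s - s ^ 2 / 2)| ≤ B * δ := by
  have hb : IntegrableOn (fun s : ℝ => Real.exp ((a + 1) ^ 2) * (s ^ 4 * Real.exp (-s)
      + a * (s ^ 3 * Real.exp (-s)) + s ^ 2 * Real.exp (-s))) (Ioi 0) :=
    (((integrableOn_pow_mul_exp_neg 4).add ((integrableOn_pow_mul_exp_neg 3).const_mul a)).add
      (integrableOn_pow_mul_exp_neg 2)).const_mul _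
  refine ⟨_, fun δ hδ hδa => abs_integral_sub_le (by unfold erlangExponent; fun_prop)
    (integrableOn_pow_mul_gaussian a 1) hb fun s hs => ?_⟩
  have h1 := abs_exp_sub_exp_le (erlangExponent_le ha hδ hδa hs.le) (gaussian_exponent_le a s)
  have h2 := abs_erlangExponent_sub_le ha hδ hs.le
  rw [sub_eq_add_neg ((a + 1) ^ 2), Real.exp_add] at h1
  rw [pow_one, ← mul_sub, abs_mul, abs_of_pos hs]
  calc _ ≤ s * (δ * (s ^ 3 + a * s ^ 2 + s) * (Real.exp ((a + 1) ^ 2) * Real.exp (-s))) := by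
        gcongr
        exact h1.trans (by gcongr)
    _ = _ := by ring

lemma integral_log_erlangExponent_sub_gaussian (a : ℝ) (ha : 0 < a) :
    ∃ B, ∀ δ, 0 < δ → δ * (4 * (a + 1)) ≤ 1 →
      |(∫ s in Ioi (0 : ℝ), Real.log (1 + δ * s) / δ * (s * Real.exp (erlangExponent a δ s)))
        - ∫ s in Ioi (0 : ℝ), s ^ 2 * Real.exp (a * s - s ^ 2 / 2)| ≤ B * δ := by
  have hb : IntegrableOn (fun s : ℝ => Real.exp ((a + 1) ^ 2) * (s ^ 5 * Real.exp (-s)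
      + a * (s ^ 4 * Real.exp (-s)) + 2 * (s ^ 3 * Real.exp (-s)))) (Ioi 0) :=
    (((integrableOn_pow_mul_exp_neg 5).add ((integrableOn_pow_mul_exp_neg 4).const_mul a)).add
      ((integrableOn_pow_mul_exp_neg 3).const_mul 2)).const_mul _
  refine ⟨_, fun δ hδ hδa => abs_integral_sub_le (by unfold erlangExponent; fun_prop)
    (integrableOn_pow_mul_gaussian a 2) hb fun s hs => ?_⟩
  have h0 := erlangExponent_le ha hδ hδa hs.le
  have h1 := abs_exp_sub_exp_le h0 (gaussian_exponent_le a s)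
  have h2 := abs_erlangExponent_sub_le ha hδ hs.le
  have h3 := Real.exp_le_exp.2 h0
  rw [sub_eq_add_neg ((a + 1) ^ 2), Real.exp_add] at h1 h3
  have hx : 0 ≤ δ * s := by positivity
  have h4 : |Real.log (1 + δ * s) / δ - s| ≤ δ * s ^ 2 := by
    have l1 := log_one_add_le_self hx
    have l2 := quadratic_le_log_one_add hx
    have l3 : 0 ≤ (δ * s) ^ 2 := sq_nonneg _
    have : Real.log (1 + δ * s) / δ - s = (Real.log (1 + δ * s) - δ * s) / δ := by field_simp
    rw [this, abs_div, abs_of_pos hδ, div_le_iff₀ hδ, abs_le]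
    constructor <;> nlinarith
  set u := Real.log (1 + δ * s) / δ
  set e := Real.exp (erlangExponent a δ s)
  set g := Real.exp (a * s - s ^ 2 / 2)
  have split : u * (s * e) - s ^ 2 * g = (u - s) * s * e + s ^ 2 * (e - g) := by ring
  have he : 0 < e := Real.exp_pos _
  calc |u * (s * e) - s ^ 2 * g| ≤ |u - s| * s * e + s ^ 2 * |e - g| := by
        rw [split]
        refine (abs_add_le _ _).trans_eq ?_
        rw [abs_mul, abs_mul, abs_mul, abs_of_pos hs, abs_of_pos he, abs_of_nonneg (sq_nonneg s)]
    _ ≤ (δ * s ^ 2) * s * (Real.exp ((a + 1) ^ 2) * Real.exp (-s))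
        + s ^ 2 * (δ * (s ^ 3 + a * s ^ 2 + s) * (Real.exp ((a + 1) ^ 2) * Real.exp (-s))) := by
        gcongr
        exact h1.trans (by gcongr)
    _ = _ := by ring

lemma hasDerivAt_gaussian_weight (a s : ℝ) : HasDerivAt (fun s : ℝ => Real.exp (a * s - s ^ 2 / 2))
    ((a - s) * Real.exp (a * s - s ^ 2 / 2)) s := by
  have := (((hasDerivAt_id s).const_mul a).sub ((hasDerivAt_pow 2 s).div_const 2)).exp
  refine this.congr_deriv ?_
  simp
  ring

lemma tendsto_pow_mul_gaussian (a : ℝ) (k : ℕ) :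
    Tendsto (fun s : ℝ => s ^ k * Real.exp (a * s - s ^ 2 / 2)) atTop (𝓝 0) := by
  have h1 := (Real.tendsto_pow_mul_exp_neg_atTop_nhds_zero k).const_mul (Real.exp ((a + 1) ^ 2))
  rw [mul_zero] at h1
  refine squeeze_zero' ?_ ?_ h1
  · filter_upwards [eventually_ge_atTop 0] with s hs
    positivity
  · filter_upwards [eventually_ge_atTop 0] with s hs
    have h1 : Real.exp (a * s - s ^ 2 / 2) ≤ Real.exp ((a + 1) ^ 2) * Real.exp (-s) := by
      rw [← Real.exp_add]
      exact Real.exp_le_exp.2 (by linarith [gaussian_exponent_le a s])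
    calc _ ≤ s ^ k * (Real.exp ((a + 1) ^ 2) * Real.exp (-s)) := by gcongr
      _ = _ := by ring

lemma integral_gaussian_first_moment (a : ℝ) :
    ∫ s in Ioi (0 : ℝ), s ^ 1 * Real.exp (a * s - s ^ 2 / 2)
      = 1 + a * ∫ s in Ioi (0 : ℝ), s ^ 0 * Real.exp (a * s - s ^ 2 / 2) := by
  have h0 := integrableOn_pow_mul_gaussian a 0
  have h1 := integrableOn_pow_mul_gaussian a 1
  have h := integral_Ioi_of_hasDerivAt_of_tendsto (a := 0) (m := 0)
    (hasDerivAt_gaussian_weight a 0).continuousAt.continuousWithinAt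
    (fun s _ => (hasDerivAt_gaussian_weight a s).congr_deriv
      (by ring : _ = a * (s ^ 0 * Real.exp (a * s - s ^ 2 / 2))
        - s ^ 1 * Real.exp (a * s - s ^ 2 / 2)))
    ((h0.const_mul a).sub h1) (by simpa using tendsto_pow_mul_gaussian a 0)
  rw [integral_sub (h0.const_mul a) h1, integral_const_mul] at h
  simp only [mul_zero, ne_eq, OfNat.ofNat_ne_zero, not_false_eq_true, zero_pow, zero_div, sub_zero,
    Real.exp_zero] at h
  linarith

lemma integral_gaussian_second_moment (a : ℝ) :
    ∫ s in Ioi (0 : ℝ), s ^ 2 * Real.exp (a * s - s ^ 2 / 2)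
      = (∫ s in Ioi (0 : ℝ), s ^ 0 * Real.exp (a * s - s ^ 2 / 2))
        + a * ∫ s in Ioi (0 : ℝ), s ^ 1 * Real.exp (a * s - s ^ 2 / 2) := by
  have h0 := integrableOn_pow_mul_gaussian a 0
  have h1 := integrableOn_pow_mul_gaussian a 1
  have h2 := integrableOn_pow_mul_gaussian a 2
  have hd : ∀ s : ℝ, HasDerivAt (fun s : ℝ => s ^ 1 * Real.exp (a * s - s ^ 2 / 2))
      (s ^ 0 * Real.exp (a * s - s ^ 2 / 2) + a * (s ^ 1 * Real.exp (a * s - s ^ 2 / 2))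
        - s ^ 2 * Real.exp (a * s - s ^ 2 / 2)) s := fun s =>
    ((hasDerivAt_pow 1 s).mul (hasDerivAt_gaussian_weight a s)).congr_deriv (by norm_num; ring)
  have h := integral_Ioi_of_hasDerivAt_of_tendsto (a := 0) (m := 0)
    (hd 0).continuousAt.continuousWithinAt (fun s _ => hd s)
    ((h0.add (h1.const_mul a)).sub h2) (tendsto_pow_mul_gaussian a 1)
  have e1 := integral_sub (h0.add (h1.const_mul a)) h2
  have e2 := integral_add h0 (h1.const_mul a)
  simp only [Pi.add_apply] at e1
  rw [e1, e2, integral_const_mul] at h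
  simp only [pow_one, zero_mul, sub_zero] at h
  simp only [pow_one]
  linarith

/-- The standard normal cdf-to-density ratio as a Laplace-type integral. -/
lemma integral_gaussian_div_density (a : ℝ) :
    (∫ t in Iic a, (Real.sqrt (2 * Real.pi))⁻¹ * Real.exp (-(t ^ 2) / 2))
      / ((Real.sqrt (2 * Real.pi))⁻¹ * Real.exp (-(a ^ 2) / 2))
      = ∫ s in Ioi (0 : ℝ), s ^ 0 * Real.exp (a * s - s ^ 2 / 2) := by
  have hpi : 0 < Real.sqrt (2 * Real.pi) := by positivity
  have h1 : ∫ t in Iic a, Real.exp (-(t ^ 2) / 2)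
      = ∫ s in Ioi (0 : ℝ), Real.exp (-((a - s) ^ 2) / 2) := by
    have := ((Measure.measurePreserving_sub_left volume a).setIntegral_preimage_emb
      (MeasurableEquiv.subLeft a).measurableEmbedding (fun t => Real.exp (-(t ^ 2) / 2)) (Iic a))
    rw [← this, preimage_const_sub_Iic, sub_self, integral_Ici_eq_integral_Ioi]
  rw [integral_const_mul, mul_div_mul_left _ _ (by positivity), h1, ← integral_div]
  refine setIntegral_congr_fun measurableSet_Ioi fun s _ => ?_
  rw [← Real.exp_sub, pow_zero, one_mul]
  congr 1
  ring

lemma erlangKernel_comp_mul {a δ s : ℝ} (hδ : 0 < δ) (hs : 0 < s) :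
    erlangKernel (δ ^ 2)⁻¹ ((δ ^ 2)⁻¹ + a / δ - 1) (δ * s)
      = δ * (s * Real.exp (erlangExponent a δ s)) := by
  have h1 : (0 : ℝ) < 1 + δ * s := by positivity
  unfold erlangKernel erlangExponent
  rw [Real.rpow_def_of_pos h1, mul_assoc, ← Real.exp_add, mul_assoc, mul_comm (Real.log _)]
  congr 4
  field_simp

lemma scaled_erlangIntegral {a δ : ℝ} (hδ : 0 < δ) :
    (δ ^ 2)⁻¹ * ∫ t in Ioi (0 : ℝ), erlangKernel (δ ^ 2)⁻¹ ((δ ^ 2)⁻¹ + a / δ - 1) t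
      = ∫ s in Ioi (0 : ℝ), s * Real.exp (erlangExponent a δ s) := by
  have h1 := integral_comp_mul_left_Ioi
    (erlangKernel (δ ^ 2)⁻¹ ((δ ^ 2)⁻¹ + a / δ - 1)) 0 hδ
  rw [setIntegral_congr_fun measurableSet_Ioi fun s hs => erlangKernel_comp_mul hδ hs,
    integral_const_mul, mul_zero, smul_eq_mul] at h1
  rw [inv_mul_eq_iff_eq_mul₀ (by positivity), sq, mul_assoc, h1]
  field_simp

lemma scaled_log_erlangIntegral {a δ : ℝ} (hδ : 0 < δ) :
    (δ ^ 2)⁻¹ * (∫ t in Ioi (0 : ℝ), Real.log (1 + t)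
        * erlangKernel (δ ^ 2)⁻¹ ((δ ^ 2)⁻¹ + a / δ - 1) t) / δ
      = ∫ s in Ioi (0 : ℝ), Real.log (1 + δ * s) / δ * (s * Real.exp (erlangExponent a δ s)) := by
  have h1 := integral_comp_mul_left_Ioi
    (fun t => Real.log (1 + t) * erlangKernel (δ ^ 2)⁻¹ ((δ ^ 2)⁻¹ + a / δ - 1) t) 0 hδ
  have h2 : ∀ s ∈ Ioi (0 : ℝ), Real.log (1 + δ * s)
      * erlangKernel (δ ^ 2)⁻¹ ((δ ^ 2)⁻¹ + a / δ - 1) (δ * s)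
      = δ ^ 2 * (Real.log (1 + δ * s) / δ * (s * Real.exp (erlangExponent a δ s))) := by
    intro s hs
    rw [erlangKernel_comp_mul hδ hs]
    field_simp
  rw [setIntegral_congr_fun measurableSet_Ioi h2, integral_const_mul, mul_zero, smul_eq_mul] at h1
  rw [mul_div_assoc, inv_mul_eq_iff_eq_mul₀ (by positivity), h1]
  field_simp

/-- Quadratic growth of `β ↦ c β + h C(β) / β` around `a`, from a tangent line of `C` at `a`. -/
lemma cost_lower_bound {c h a b C0 C1 Cb : ℝ} (hh : 0 < h) (ha : 0 < a) (hb : 0 < b)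
    (hC1 : 0 ≤ C1) (hC : C0 - C1 * (b - a) ≤ Cb) :
    c * a + h * C0 / a + (c - h * C0 / a ^ 2 - h * C1 / a) * (b - a)
      + h * C0 / a ^ 2 * ((b - a) ^ 2 / b) ≤ c * b + h * Cb / b := by
  have h1 : h * (C0 - C1 * (b - a)) / b ≤ h * Cb / b := by gcongr
  have h2 : c * b + h * (C0 - C1 * (b - a)) / b
      - (c * a + h * C0 / a + (c - h * C0 / a ^ 2 - h * C1 / a) * (b - a)
        + h * C0 / a ^ 2 * ((b - a) ^ 2 / b)) = h * C1 * (b - a) ^ 2 / (a * b) := by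
    field_simp
    ring
  have h3 : 0 ≤ h * C1 * (b - a) ^ 2 / (a * b) := by positivity
  linarith

lemma neg_sq_le_linear_add_quadratic {a b D κ κ0 : ℝ} (ha : 0 < a) (hb : 0 < b) (hκ0 : 0 < κ0)
    (hκ : κ0 ≤ κ) (hD : |D| ≤ κ0 / 2) :
    -(D ^ 2 * a / (2 * κ0)) ≤ D * (b - a) + κ * ((b - a) ^ 2 / b) := by
  have hq : κ0 * ((b - a) ^ 2 / b) ≤ κ * ((b - a) ^ 2 / b) := by gcongr
  have h0 : 0 ≤ D ^ 2 * a / (2 * κ0) := by positivity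
  rcases le_total b (2 * a) with h | h
  · have h1 : (b - a) ^ 2 / (2 * a) ≤ (b - a) ^ 2 / b := by gcongr
    have h2 : κ0 * ((b - a) ^ 2 / (2 * a)) ≤ κ0 * ((b - a) ^ 2 / b) := by gcongr
    have h3 : D * (b - a) + κ0 * ((b - a) ^ 2 / (2 * a)) + D ^ 2 * a / (2 * κ0)
        = (κ0 * (b - a) + D * a) ^ 2 / (2 * a * κ0) := by
      field_simp
      ring
    have h4 : 0 ≤ (κ0 * (b - a) + D * a) ^ 2 / (2 * a * κ0) := by positivity
    linarith
  · have h1 : (b - a) / 2 ≤ (b - a) ^ 2 / b := by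
      rw [le_div_iff₀ hb]
      nlinarith
    have h2 : κ0 * ((b - a) / 2) ≤ κ0 * ((b - a) ^ 2 / b) := by gcongr
    have h3 : -(κ0 / 2) * (b - a) ≤ D * (b - a) := by
      gcongr
      · linarith
      · exact (abs_le.1 hD).1
    linarith

lemma inv_sub_le_inv_of_tangent {A Ab A1 d : ℝ} (hA : 0 < A) (hAb : 0 < Ab)
    (h : A * (Ab - A) ≤ d * A1 * Ab) : A⁻¹ - A1 / A ^ 2 * d ≤ Ab⁻¹ := by
  have : Ab⁻¹ - (A⁻¹ - A1 / A ^ 2 * d) = (d * A1 * Ab - A * (Ab - A)) / (A ^ 2 * Ab) := by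
    field_simp
    ring
  have h2 : 0 ≤ (d * A1 * Ab - A * (Ab - A)) / (A ^ 2 * Ab) :=
    div_nonneg (by linarith) (by positivity)
  linarith

/-- First-order optimality of a minimizer of the Halfin–Whitt cost function. -/
lemma halfinWhitt_first_order {c h a : ℝ} {φ Φ pibar : ℝ → ℝ} (ha : 0 < a)
    (hφ : ∀ x, φ x = (Real.sqrt (2 * Real.pi))⁻¹ * Real.exp (-(x ^ 2) / 2))
    (hΦ : ∀ x, Φ x = ∫ t in Iic x, φ t)
    (hpi : ∀ x, pibar x = c * x + h * ((1 / x) * (1 + x * Φ x / φ x)⁻¹))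
    (hopt : ∀ y ∈ Ioi (0 : ℝ), pibar a ≤ pibar y) {J J2 : ℝ}
    (hJ : J = ∫ s in Ioi (0 : ℝ), s ^ 1 * Real.exp (a * s - s ^ 2 / 2))
    (hJ2 : J2 = ∫ s in Ioi (0 : ℝ), s ^ 2 * Real.exp (a * s - s ^ 2 / 2)) (hJpos : 0 < J) :
    c - h * J⁻¹ / a ^ 2 - h * (J2 / J ^ 2) / a = 0 := by
  have hφpos : ∀ x, 0 < φ x := fun x => by rw [hφ]; positivity
  have hφcont : Continuous φ := by
    rw [show φ = _ from funext hφ]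
    fun_prop
  have hφint : Integrable φ := by
    rw [show φ = _ from funext hφ]
    have := (integrable_exp_neg_mul_sq (b := 1 / 2) (by norm_num)).const_mul
      (Real.sqrt (2 * Real.pi))⁻¹
    refine this.congr (Eventually.of_forall fun x => ?_)
    simp only
    ring_nf
  have hM : Φ a / φ a = ∫ s in Ioi (0 : ℝ), s ^ 0 * Real.exp (a * s - s ^ 2 / 2) := by
    rw [← integral_gaussian_div_density, hΦ, hφ]
    simp_rw [hφ]
  have hJe : J = 1 + a * (Φ a / φ a) := by rw [hJ, hM, integral_gaussian_first_moment]
  have hJ2e : J2 = Φ a / φ a + a * J := by rw [hJ2, hM, hJ, integral_gaussian_second_moment]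
  have dφ : HasDerivAt φ (-a * φ a) a := by
    rw [hφ a, show φ = _ from funext hφ]
    have := ((((hasDerivAt_pow 2 a).neg).div_const 2).exp).const_mul (Real.sqrt (2 * Real.pi))⁻¹
    refine this.congr_deriv ?_
    simp
    ring
  have dΦ : HasDerivAt Φ (φ a) a := by
    have h1 : HasDerivAt (fun x => ∫ t in a..x, φ t) (φ a) a :=
      intervalIntegral.integral_hasDerivAt_right (hφcont.intervalIntegrable _ _)
        hφcont.stronglyMeasurable.stronglyMeasurableAtFilter hφcont.continuousAt
    refine (h1.const_add (Φ a)).congr_of_eventuallyEq (Eventually.of_forall fun x => ?_)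
    simp only
    rw [hΦ, hΦ, ← intervalIntegral.integral_Iic_sub_Iic hφint.integrableOn hφint.integrableOn]
    ring
  have dM : HasDerivAt (fun x => Φ x / φ x) J a := by
    refine (dΦ.div dφ (hφpos a).ne').congr_deriv ?_
    have := hφpos a
    rw [hJe]
    field_simp
    ring
  have dJ : HasDerivAt (fun x => x * (1 + x * (Φ x / φ x))) (J + a * J2) a := by
    have := (hasDerivAt_id a).mul (((hasDerivAt_id a).mul dM).const_add 1)
    refine this.congr_deriv ?_
    simp only [id]
    rw [hJ2e, hJe]
    simp
  have hne : a * (1 + a * (Φ a / φ a)) ≠ 0 := by rw [← hJe]; positivity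
  have dpi : HasDerivAt pibar (c * 1 + h * (-(J + a * J2) / (a * J) ^ 2)) a := by
    have := ((hasDerivAt_id a).const_mul c).add ((dJ.inv hne).const_mul h)
    rw [← hJe] at this
    refine this.congr_of_eventuallyEq (Eventually.of_forall fun x => ?_)
    rw [hpi]
    simp [mul_div_assoc, mul_comm]
  have hmin : IsLocalMin pibar a := by
    filter_upwards [Ioi_mem_nhds ha] with y hy using hopt y hy
  have := hmin.hasDerivAt_eq_zero dpi
  rw [← this]
  field_simp
  ring

/-- In the Halfin–Whitt scaling the optimality gap of a stationary point of the limiting cost is of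
second order in `δ`. -/
lemma scaled_cost_gap {c h a : ℝ} (hh : 0 < h) (ha : 0 < a) {J J2 : ℝ}
    (hJ : J = ∫ s in Ioi (0 : ℝ), s ^ 1 * Real.exp (a * s - s ^ 2 / 2))
    (hJ2 : J2 = ∫ s in Ioi (0 : ℝ), s ^ 2 * Real.exp (a * s - s ^ 2 / 2)) (hJpos : 0 < J)
    (hstat : c - h * J⁻¹ / a ^ 2 - h * (J2 / J ^ 2) / a = 0) :
    ∃ K, ∀ᶠ δ in 𝓝[>] (0 : ℝ), ∀ b, 0 < b →
      c * a + h * ((δ ^ 2)⁻¹ *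
        ∫ t in Ioi (0 : ℝ), erlangKernel (δ ^ 2)⁻¹ ((δ ^ 2)⁻¹ + a / δ - 1) t)⁻¹ / a ≤
      c * b + h * ((δ ^ 2)⁻¹ *
        ∫ t in Ioi (0 : ℝ), erlangKernel (δ ^ 2)⁻¹ ((δ ^ 2)⁻¹ + b / δ - 1) t)⁻¹ / b + K * δ ^ 2 := by
  set A : ℝ → ℝ := fun δ => ∫ s in Ioi (0 : ℝ), s * Real.exp (erlangExponent a δ s) with hA
  set A1 : ℝ → ℝ := fun δ =>
    ∫ s in Ioi (0 : ℝ), Real.log (1 + δ * s) / δ * (s * Real.exp (erlangExponent a δ s)) with hA1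
  have hsmall : ∀ᶠ δ in 𝓝[>] (0 : ℝ), 0 < δ ∧ δ * (4 * (a + 1)) ≤ 1 := by
    have h1 : ∀ᶠ δ in 𝓝[>] (0 : ℝ), δ < (4 * (a + 1))⁻¹ :=
      nhdsWithin_le_nhds (Iio_mem_nhds (by positivity))
    filter_upwards [h1, self_mem_nhdsWithin] with δ hδ h0
    refine ⟨h0, ?_⟩
    rw [← le_div_iff₀ (by positivity), one_div]
    exact hδ.le
  have hAO : (fun δ => A δ - J) =O[𝓝[>] 0] fun δ => δ := by
    obtain ⟨B, hB⟩ := integral_erlangExponent_sub_gaussian a ha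
    refine Asymptotics.IsBigO.of_bound B ?_
    filter_upwards [hsmall] with δ hδ
    rw [Real.norm_eq_abs, Real.norm_of_nonneg hδ.1.le, hJ]
    exact hB δ hδ.1 hδ.2
  have hA1O : (fun δ => A1 δ - J2) =O[𝓝[>] 0] fun δ => δ := by
    obtain ⟨B, hB⟩ := integral_log_erlangExponent_sub_gaussian a ha
    refine Asymptotics.IsBigO.of_bound B ?_
    filter_upwards [hsmall] with δ hδ
    rw [Real.norm_eq_abs, Real.norm_of_nonneg hδ.1.le, hJ2]
    exact hB δ hδ.1 hδ.2
  have hid : Tendsto (fun δ : ℝ => δ) (𝓝[>] 0) (𝓝 0) := nhdsWithin_le_nhds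
  have hAt : Tendsto A (𝓝[>] 0) (𝓝 J) := by
    simpa using (hAO.trans_tendsto hid).add_const J
  have hA1t : Tendsto A1 (𝓝[>] 0) (𝓝 J2) := by
    simpa using (hA1O.trans_tendsto hid).add_const J2
  set ψ : ℝ × ℝ → ℝ := fun p => c - h * p.1⁻¹ / a ^ 2 - h * (p.2 / p.1 ^ 2) / a with hψ
  have hψd : DifferentiableAt ℝ ψ (J, J2) := by
    have : J ^ 2 ≠ 0 := by positivity
    rw [hψ]
    fun_prop (disch := simp; positivity)
  have hDO : (fun δ => ψ (A δ, A1 δ)) =O[𝓝[>] 0] fun δ => δ := by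
    have h1 := hψd.hasFDerivAt.isBigO_sub.comp_tendsto (hAt.prodMk_nhds hA1t)
    have h2 : ψ (J, J2) = 0 := hstat
    simp only [h2, sub_zero] at h1
    exact h1.trans (hAO.prod_left hA1O)
  have hDt : Tendsto (fun δ => ψ (A δ, A1 δ)) (𝓝[>] 0) (𝓝 0) := hDO.trans_tendsto hid
  set κ0 := h * J⁻¹ / a ^ 2 / 2 with hκ0
  have hκ0pos : 0 < κ0 := by positivity
  have hκev : ∀ᶠ δ in 𝓝[>] (0 : ℝ), κ0 < h * (A δ)⁻¹ / a ^ 2 := by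
    have : Tendsto (fun δ => h * (A δ)⁻¹ / a ^ 2) (𝓝[>] 0) (𝓝 (h * J⁻¹ / a ^ 2)) :=
      ((hAt.inv₀ hJpos.ne').const_mul h).div_const _
    refine this.eventually_const_lt ?_
    have : 0 < h * J⁻¹ / a ^ 2 := by positivity
    linarith
  have hDsmall : ∀ᶠ δ in 𝓝[>] (0 : ℝ), |ψ (A δ, A1 δ)| < κ0 / 2 := by
    have := hDt.abs
    rw [abs_zero] at this
    exact this.eventually_lt_const (by positivity)
  obtain ⟨B, hB⟩ := hDO.bound
  refine ⟨B ^ 2 * a / (2 * κ0), ?_⟩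
  filter_upwards [hsmall, hκev, hDsmall, hB] with δ hδ hκ hDs hDB b hb
  obtain ⟨hδ0, -⟩ := hδ
  have hR : 0 < (δ ^ 2)⁻¹ := by positivity
  set R := (δ ^ 2)⁻¹ with hRdef
  have hApos : 0 < A δ := by
    rw [hA]
    simp only
    rw [← scaled_erlangIntegral hδ0]
    exact mul_pos hR (integral_erlangKernel_pos hR _)
  have htan := erlangIntegral_tangent hR (R + a / δ - 1) ((b - a) / δ)
  have hy : R + a / δ - 1 + (b - a) / δ = R + b / δ - 1 := by ring
  rw [hy] at htan
  have eA : R * ∫ t in Ioi (0 : ℝ), erlangKernel R (R + a / δ - 1) t = A δ :=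
    scaled_erlangIntegral hδ0
  have eA1 : R * (∫ t in Ioi (0 : ℝ), Real.log (1 + t) * erlangKernel R (R + a / δ - 1) t) / δ
      = A1 δ := scaled_log_erlangIntegral hδ0
  have hQ : 0 < ∫ t in Ioi (0 : ℝ), Real.log (1 + t) * erlangKernel R (R + a / δ - 1) t :=
    setIntegral_Ioi_pos (integrableOn_log_mul_erlangKernel hR _) fun t ht =>
      mul_pos (Real.log_pos (by linarith)) (erlangKernel_pos _ _ ht)
  have hA1pos : 0 < A1 δ := by
    rw [← eA1]
    positivity
  rw [eA]
  set Pa := ∫ t in Ioi (0 : ℝ), erlangKernel R (R + a / δ - 1) t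
  set Pb := ∫ t in Ioi (0 : ℝ), erlangKernel R (R + b / δ - 1) t
  set Q := ∫ t in Ioi (0 : ℝ), Real.log (1 + t) * erlangKernel R (R + a / δ - 1) t
  have hPb : 0 < Pb := integral_erlangKernel_pos hR _
  have htan' : A δ * (R * Pb - A δ) ≤ (b - a) * A1 δ * (R * Pb) := by
    rw [← eA, ← eA1]
    have := mul_le_mul_of_nonneg_left htan (sq_nonneg R)
    calc _ = R ^ 2 * (Pa * (Pb - Pa)) := by ring
      _ ≤ _ := this
      _ = _ := by ring
  have hC := inv_sub_le_inv_of_tangent hApos (mul_pos hR hPb) htan'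
  have h1 := cost_lower_bound (c := c) hh ha hb (C1 := A1 δ / A δ ^ 2) (by positivity) hC
  have h2 := neg_sq_le_linear_add_quadratic ha hb hκ0pos hκ.le hDs.le
  have h3 : ψ (A δ, A1 δ) ^ 2 * a / (2 * κ0) ≤ B ^ 2 * a / (2 * κ0) * δ ^ 2 := by
    rw [Real.norm_eq_abs, Real.norm_of_nonneg hδ0.le] at hDB
    have : ψ (A δ, A1 δ) ^ 2 ≤ (B * δ) ^ 2 := by
      rw [← sq_abs (ψ _)]
      gcongr
    calc _ ≤ (B * δ) ^ 2 * a / (2 * κ0) := by gcongr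
      _ = _ := by ring
  simp only [hψ] at h2 h3
  linarith

/-- `O(1/√n)`-optimality of square-root staffing in the `M/M/N` queue:
with `x̄*` the unique minimizer over `(0,∞)` of `π̄(x) = c·x + h·q̄(x)`, the optimality
gap of the square-root staffing prescription is `O(1/√n)`:
`limsup_{n→∞} √n·[Π_n(n/μ + √(n/μ)·x̄*) - inf_{x > n/μ} Π_n(x)] < ∞`. -/
theorem sqrt_staffing_O_inv_sqrt_optimal_MMN
    (μ c h : ℝ) (hμ : 0 < μ) (hc : 0 < c) (hh : 0 < h)
    -- standard normal density and cdf
    (φ Φ : ℝ → ℝ)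
    (hφ : ∀ x, φ x = (Real.sqrt (2 * Real.pi))⁻¹ * Real.exp (-(x ^ 2) / 2))
    (hΦ : ∀ x, Φ x = ∫ t in Set.Iic x, φ t)
    -- extended Erlang-C blocking probability
    (Cblock : ℕ → ℝ → ℝ)
    (hCblock : ∀ (n : ℕ) (x : ℝ), Cblock n x =
      (((n : ℝ) / μ) *
        ∫ t in Set.Ioi (0 : ℝ),
          t * Real.exp (-((n : ℝ) / μ) * t) * (1 + t) ^ (x - 1))⁻¹)
    -- steady-state expected queue length
    (EQ : ℕ → ℝ → ℝ)
    (hEQ : ∀ (n : ℕ) (x : ℝ), EQ n x = (n : ℝ) * Cblock n x / (x * μ - (n : ℝ)))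
    -- total staffing cost
    (Cost : ℕ → ℝ → ℝ)
    (hCost : ∀ (n : ℕ) (x : ℝ), Cost n x = h * EQ n x + c * x)
    -- limiting (Halfin–Whitt) cost function
    (qbar : ℝ → ℝ)
    (hqbar : ∀ x, qbar x = (1 / x) * (1 + x * Φ x / φ x)⁻¹)
    (pibar : ℝ → ℝ)
    (hpibar : ∀ x, pibar x = c * x + h * qbar x)
    -- `x̄*` is the unique minimizer of `π̄` over `(0,∞)`
    (xbar : ℝ) (hxbar : xbar ∈ Set.Ioi (0 : ℝ))
    (hxopt : ∀ y ∈ Set.Ioi (0 : ℝ), pibar xbar ≤ pibar y)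
    (hxuniq : ∀ y ∈ Set.Ioi (0 : ℝ),
      (∀ z ∈ Set.Ioi (0 : ℝ), pibar y ≤ pibar z) → y = xbar) :
    Filter.limsup
      (fun n : ℕ =>
        ((Real.sqrt (n : ℝ) *
          (Cost n ((n : ℝ) / μ + Real.sqrt ((n : ℝ) / μ) * xbar)
            - sInf (Cost n '' Set.Ioi ((n : ℝ) / μ))) : ℝ) : EReal))
      atTop < ⊤ := by
  have hstat := halfinWhitt_first_order hxbar hφ hΦ
    (fun x => by rw [hpibar, hqbar]) hxopt rfl rfl
  have hJpos : 0 < ∫ s in Ioi (0 : ℝ), s ^ 1 * Real.exp (xbar * s - s ^ 2 / 2) :=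
    setIntegral_Ioi_pos (integrableOn_pow_mul_gaussian xbar 1) fun s hs => by positivity
  obtain ⟨K, hK⟩ := scaled_cost_gap (c := c) hh hxbar rfl rfl hJpos (hstat hJpos)
  have hR : Tendsto (fun n : ℕ => Real.sqrt ((n : ℝ) / μ)) atTop atTop :=
    Real.tendsto_sqrt_atTop.comp (tendsto_natCast_atTop_atTop.atTop_div_const hμ)
  have hδ : Tendsto (fun n : ℕ => (Real.sqrt ((n : ℝ) / μ))⁻¹) atTop (𝓝[>] 0) :=
    tendsto_inv_atTop_nhdsGT_zero.comp hR
  refine lt_of_le_of_lt (limsup_le_of_le (a := ((Real.sqrt μ * K : ℝ) : EReal)) (by isBoundedDefault) ?_)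
    (EReal.coe_lt_top _)
  filter_upwards [hδ.eventually hK, eventually_gt_atTop 0] with n hn hn0
  rw [EReal.coe_le_coe_iff]
  have hn0' : (0 : ℝ) < n := Nat.cast_pos.2 hn0
  have hRpos : 0 < (n : ℝ) / μ := by positivity
  set q := Real.sqrt ((n : ℝ) / μ) with hq
  have hqpos : 0 < q := Real.sqrt_pos.2 hRpos
  have hq2 : q ^ 2 = (n : ℝ) / μ := Real.sq_sqrt hRpos.le
  have hnq : (n : ℝ) = μ * q ^ 2 := by rw [hq2]; field_simp
  have hsn : Real.sqrt n = Real.sqrt μ * q := by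
    rw [hnq, Real.sqrt_mul hμ.le, Real.sqrt_sq hqpos.le]
  have hCost' : ∀ b, 0 < b → Cost n ((n : ℝ) / μ + q * b) = c * q ^ 2 + q * (c * b + h *
      (((q⁻¹ ^ 2)⁻¹ * ∫ t in Ioi (0 : ℝ),
        erlangKernel (q⁻¹ ^ 2)⁻¹ ((q⁻¹ ^ 2)⁻¹ + b / q⁻¹ - 1) t)⁻¹) / b) := by
    intro b hb
    have e1 : (q⁻¹ ^ 2)⁻¹ = (n : ℝ) / μ := by rw [inv_pow, inv_inv, hq2]
    have e2 : b / q⁻¹ = q * b := by rw [div_inv_eq_mul, mul_comm]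
    have e3 : ((n : ℝ) / μ + q * b) * μ - n = μ * q * b := by field_simp; ring
    rw [hCost, hEQ, hCblock, e1, e2, e3]
    simp only [erlangKernel]
    set C := ((n : ℝ) / μ * ∫ t in Ioi (0 : ℝ),
      t * Real.exp (-((n : ℝ) / μ) * t) * (1 + t) ^ ((n : ℝ) / μ + q * b - 1))⁻¹
    rw [← hq2, hnq]
    field_simp
    ring
  have hgap : ∀ x ∈ Ioi ((n : ℝ) / μ), Cost n ((n : ℝ) / μ + q * xbar) - K / q ≤ Cost n x := by
    intro x hx
    have hx' : 0 < (x - (n : ℝ) / μ) / q := div_pos (sub_pos.2 hx) hqpos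
    have e : x = (n : ℝ) / μ + q * ((x - (n : ℝ) / μ) / q) := by field_simp; ring
    rw [e, hCost' _ hx', hCost' _ hxbar]
    have := mul_le_mul_of_nonneg_left (hn _ hx') hqpos.le
    have e4 : q * (K * q⁻¹ ^ 2) = K / q := by field_simp
    rw [mul_add q _ (K * q⁻¹ ^ 2), e4] at this
    linarith
  have hinf : Cost n ((n : ℝ) / μ + q * xbar) - K / q ≤ sInf (Cost n '' Ioi ((n : ℝ) / μ)) := by
    refine le_csInf (nonempty_Ioi.image _) ?_
    rintro _ ⟨x, hx, rfl⟩
    exact hgap x hx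
  rw [hsn]
  calc _ ≤ Real.sqrt μ * q * (K / q) := by gcongr; linarith
    _ = Real.sqrt μ * K := by field_simp
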